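/- arXiv:1808.03290 — 4 statements merged into one kernel-verified Lean document; each statement's English description precedes it below -/
import Mathlib

section
/- For every unit u of o_S there exist a unit w of ℍ[o_S, c, t] and a unit v of o_S such that the reduced norm of w satisfies w·star(w) = u·v². Equivalently, the map Λ_S → o_Sˣ/(o_Sˣ)² induced by the reduced norm is surjective. -/
open Polynomial Quaternion

noncomputable section

/-- The multiplicative set of `𝔽_q[t]` generated by `t` and `t - τ` for `τ ∈ S₀`. -/
def sden (F : Type) [Field F] (S₀ : Set F) : Submonoid F[X] :=
  Submonoid.closure ({X} ∪ (fun τ : F => X - C τ) '' S₀)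

/-- The ring `o_S`, the localization of `𝔽_q[t]` inverting `t` and `t - τ` for `τ ∈ S₀`. -/
abbrev OS (F : Type) [Field F] (S₀ : Set F) := Localization (sden F S₀)

/-- The quaternion algebra `ℍ[o_S, c, t]` with `i² = c`, `j² = t`, `ij = -ji = k`. -/
abbrev QAS (F : Type) [Field F] (S₀ : Set F) (c : F) : Type :=
  ℍ[OS F S₀, algebraMap F[X] (OS F S₀) (C c), algebraMap F[X] (OS F S₀) X]

section QuaternionNorms

variable {R : Type*} [CommRing R] {α β : R}

/-- The submonoid of scalars that are reduced norms from `ℍ[R, α, β]`. -/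
def reducedNorms (α β : R) : Submonoid R where
  carrier := {x | ∃ w : ℍ[R, α, β], w * star w = algebraMap R ℍ[R, α, β] x}
  one_mem' := ⟨1, by simp⟩
  mul_mem' := by
    rintro x y ⟨w, hw⟩ ⟨z, hz⟩
    refine ⟨w * z, ?_⟩
    rw [star_mul, mul_assoc, ← mul_assoc z, hz, Algebra.commutes, ← mul_assoc, hw, map_mul]

theorem mem_reducedNorms_of_eq {x : R} (a b d e : R)
    (h : a ^ 2 - α * b ^ 2 - β * (d ^ 2 - α * e ^ 2) = x) : x ∈ reducedNorms α β := by
  refine ⟨⟨a, b, d, e⟩, ?_⟩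
  rw [QuaternionAlgebra.coe_algebraMap]
  ext
  · simp
    linear_combination h
  all_goals
    simp
    ring

/-- An element of `ℍ[R, α, β]` whose reduced norm is a unit is itself a unit. -/
theorem exists_unit_of_mem_reducedNorms {x : R} (hx : IsUnit x) (h : x ∈ reducedNorms α β) :
    ∃ w : ℍ[R, α, β]ˣ,
      (w : ℍ[R, α, β]) * star (w : ℍ[R, α, β]) = algebraMap R ℍ[R, α, β] x := by
  obtain ⟨w, hw⟩ := h
  have hu : IsUnit (w * star w) := hw ▸ hx.map _
  have hcomm : Commute w (star w) := (star_comm_self' w).symm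
  obtain ⟨z, hz⟩ := (hcomm.isUnit_mul_iff.mp hu).1
  exact ⟨z, by rw [hz, hw]⟩

end QuaternionNorms

/-- Over a finite field of odd order the form `a ^ 2 - c * b ^ 2` represents every element. -/
theorem exists_sq_sub_mul_sq_eq {F : Type*} [Field F] [Fintype F] (hq : Odd (Fintype.card F))
    {c : F} (hc : c ≠ 0) (x : F) : ∃ a b : F, a ^ 2 - c * b ^ 2 = x := by
  obtain ⟨a, b, h⟩ := FiniteField.exists_root_sum_quadratic
    (f := X ^ 2 - C x) (g := C (-c) * X ^ 2) (degree_X_pow_sub_C two_pos x)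
    (degree_C_mul_X_pow 2 (neg_ne_zero.mpr hc)) (Nat.odd_iff.mp hq)
  refine ⟨a, b, ?_⟩
  simp at h
  linear_combination h

/-- Linear and constant polynomials are reduced norms over every `F[X]`-algebra. -/
theorem algebraMap_linear_mem_reducedNorms {F : Type*} [Field F] [Fintype F]
    (hq : Odd (Fintype.card F)) {c : F} (hc : c ≠ 0) {R : Type*} [CommRing R] [Algebra F[X] R]
    (x y : F) : algebraMap F[X] R (C x + C y * X) ∈
      reducedNorms (algebraMap F[X] R (C c)) (algebraMap F[X] R X) := by
  obtain ⟨a, b, hab⟩ := exists_sq_sub_mul_sq_eq hq hc x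
  obtain ⟨d, e, hde⟩ := exists_sq_sub_mul_sq_eq hq hc (-y)
  refine mem_reducedNorms_of_eq (algebraMap F[X] R (C a)) (algebraMap F[X] R (C b))
    (algebraMap F[X] R (C d)) (algebraMap F[X] R (C e)) ?_
  rw [← neg_neg y, ← hab, ← hde]
  simp only [map_add, map_sub, map_mul, map_pow, map_neg]
  ring

/-- Every divisor of an element of `sden F S₀` is a reduced norm. -/
theorem algebraMap_mem_reducedNorms_of_dvd {F : Type} [Field F] [Fintype F]
    (hq : Odd (Fintype.card F)) {c : F} (hc : c ≠ 0) {S₀ : Set F}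
    {R : Type*} [CommRing R] [Algebra F[X] R] {s : F[X]} (hs : s ∈ sden F S₀) :
    ∀ p, p ∣ s → algebraMap F[X] R p ∈
      reducedNorms (algebraMap F[X] R (C c)) (algebraMap F[X] R X) := by
  have hunit (p : F[X]) (hp : IsUnit p) : algebraMap F[X] R p ∈
      reducedNorms (algebraMap F[X] R (C c)) (algebraMap F[X] R X) := by
    obtain ⟨x, -, rfl⟩ := Polynomial.isUnit_iff.mp hp
    simpa using algebraMap_linear_mem_reducedNorms (R := R) hq hc x 0
  have hlinear (τ : F) (p : F[X]) (hp : p ∣ X - C τ) : algebraMap F[X] R p ∈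
      reducedNorms (algebraMap F[X] R (C c)) (algebraMap F[X] R X) := by
    rcases (irreducible_X_sub_C τ).dvd_iff.mp hp with h | h
    · exact hunit p h
    · obtain ⟨v, rfl⟩ := h
      rw [map_mul]
      refine mul_mem ?_ (hunit v v.isUnit)
      convert algebraMap_linear_mem_reducedNorms (R := R) hq hc (-τ) 1 using 2
      simp [sub_eq_neg_add]
  induction hs using Submonoid.closure_induction with
  | mem x hx =>
    rcases hx with rfl | ⟨τ, -, rfl⟩
    · simpa using hlinear 0
    · exact hlinear τ
  | one => exact fun p hp => hunit p (isUnit_of_dvd_one hp)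
  | mul x y _ _ ihx ihy =>
    intro p hp
    obtain ⟨a, b, ha, hb, rfl⟩ := exists_dvd_and_dvd_of_dvd_mul hp
    rw [map_mul]
    exact mul_mem (ihx a ha) (ihy b hb)

/-- For every unit `u` of `o_S` there exist a unit `w` of `ℍ[o_S, c, t]`
and a unit `v` of `o_S` such that the reduced norm of `w` satisfies
`w·star(w) = u·v²`; i.e. the reduced norm map `Λ_S → o_Sˣ/(o_Sˣ)²` is surjective. -/
theorem reducedNorm_surjective_mod_squares
    (F : Type) [Field F] [Fintype F] (hq : Odd (Fintype.card F))
    (c : F) (hc : ¬IsSquare c)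
    (S₀ : Set F) (hS₀ : (0 : F) ∉ S₀) :
    ∀ u : (OS F S₀)ˣ, ∃ (w : (QAS F S₀ c)ˣ) (v : (OS F S₀)ˣ),
      (w : QAS F S₀ c) * star (w : QAS F S₀ c) =
        algebraMap (OS F S₀) (QAS F S₀ c) ((u : OS F S₀) * (v : OS F S₀) ^ 2) := by
  intro u
  have hc0 : c ≠ 0 := fun h => hc (h ▸ IsSquare.zero)
  obtain ⟨⟨p, s⟩, hps⟩ := IsLocalization.surj (sden F S₀) (u : OS F S₀)
  have hs := IsLocalization.map_units (OS F S₀) s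
  have hp : IsUnit (algebraMap F[X] (OS F S₀) p) := hps ▸ u.isUnit.mul hs
  obtain ⟨r, hr⟩ := (IsLocalization.algebraMap_isUnit_iff (sden F S₀)).mp hp
  have hmem := mul_mem
    (algebraMap_mem_reducedNorms_of_dvd (R := OS F S₀) hq hc0 hr.1 p hr.2)
    (algebraMap_mem_reducedNorms_of_dvd (R := OS F S₀) hq hc0 s.2 s dvd_rfl)
  obtain ⟨w, hw⟩ := exists_unit_of_mem_reducedNorms (hp.mul hs) hmem
  refine ⟨w, hs.unit, hw.trans (congrArg _ ?_)⟩
  rw [← hps, IsUnit.unit_spec]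
  ring
end
end

section
/- Let K = 𝔽_q(t) and τ ∈ 𝔽_qˣ, and let A_τ = {1 + α·j : α ∈ 𝔽_{q²}, N(α) = τ⁻¹} ⊆ ℍ[K, c, t]. Then: (1) A_τ has exactly q + 1 elements; (2) for every μ = u + v·i with (u,v) ≠ (0,0) and every α with N(α) = τ⁻¹, one has μ(1 + α·j)μ⁻¹ = 1 + (α·μ/μ̄)·j, and j(1 + α·j)j⁻¹ = 1 + ᾱ·j; (3) for any α, α′ ∈ 𝔽_{q²} with N(α) = N(α′) = τ⁻¹ there exists μ ∈ 𝔽_{q²}ˣ ⊆ ℍ[K, c, t]ˣ such that μ(1 + α·j)μ⁻¹ = 1 + α′·j; in particular conjugation by units acts transitively on A_τ. -/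
open Polynomial Quaternion

noncomputable section

/-- The quaternion algebra `ℍ[K, c, t]` over `K = 𝔽_q(t)`, with `i² = c`, `j² = t`,
`ij = -ji = k`. -/
abbrev QAK (F : Type) [Field F] (c : F) : Type :=
  ℍ[RatFunc F, RatFunc.C c, RatFunc.X]

/-- The quaternion `1 + α·j = 1 + x·j + y·k` for `α = x + y·√c ∈ 𝔽_{q²}`. -/
def oneAddJK (F : Type) [Field F] (c : F) (x y : F) : QAK F c :=
  ⟨1, 0, RatFunc.C x, RatFunc.C y⟩

/-- The quaternion `u + v·i` for `u + v·√c ∈ 𝔽_{q²}`. -/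
def scalarQK (F : Type) [Field F] (c : F) (u v : F) : QAK F c :=
  ⟨RatFunc.C u, RatFunc.C v, 0, 0⟩

/-- The quaternion `j`. -/
def jquatK (F : Type) [Field F] (c : F) : QAK F c :=
  ⟨0, 0, 1, 0⟩

/-- `α = x + y·√c` in `𝔽_{q²} = F(√c)`. -/
def hasCoord (F : Type) [Field F] (E : Type) [Field E] [Algebra F E] (s : E)
    (α : E) (x y : F) : Prop :=
  α = algebraMap F E x + algebraMap F E y * s

theorem pow_card_eq_neg_of_not_isSquare {F : Type} [Field F] [Fintype F]
    (hq : Odd (Fintype.card F)) {c : F} (hc : ¬IsSquare c)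
    {E : Type} [Field E] [Algebra F E] {s : E} (hs : s ^ 2 = algebraMap F E c) :
    s ^ Fintype.card F = -s := by
  have hF : ringChar F ≠ 2 := fun h => by
    have := FiniteField.even_card_iff_char_two.mp h
    have := Nat.odd_iff.mp hq
    omega
  have hc0 : c ≠ 0 := by
    rintro rfl
    exact hc (IsSquare.zero)
  have hpow : c ^ (Fintype.card F / 2) = -1 :=
    (FiniteField.pow_dichotomy hF hc0).resolve_left
      fun h => hc ((FiniteField.isSquare_iff hF hc0).mpr h)
  calc s ^ Fintype.card F = s ^ (2 * (Fintype.card F / 2) + 1) := by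
        rw [Nat.two_mul_div_two_add_one_of_odd hq]
    _ = -s := by rw [pow_succ, pow_mul, hs, ← map_pow, hpow]; simp

theorem hasCoord.pow_card {F : Type} [Field F] [Fintype F]
    {E : Type} [Field E] [Algebra F E] {s : E} (hs : s ^ Fintype.card F = -s)
    {α : E} {x y : F} (h : hasCoord F E s α x y) :
    hasCoord F E s (α ^ Fintype.card F) x (-y) := by
  have hfrob := map_add (FiniteField.frobeniusAlgHom F E) (algebraMap F E x) (algebraMap F E y * s)
  rw [map_mul, AlgHom.commutes, AlgHom.commutes] at hfrob
  simp only [FiniteField.coe_frobeniusAlgHom, hs] at hfrob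
  unfold hasCoord at h ⊢
  rw [h, hfrob, map_neg]
  ring

theorem hasCoord.unique {F : Type} [Field F] {c : F} (hc : ¬IsSquare c)
    {E : Type} [Field E] [Algebra F E] {s : E} (hs : s ^ 2 = algebraMap F E c)
    {α : E} {x y x' y' : F} (h : hasCoord F E s α x y) (h' : hasCoord F E s α x' y') :
    x = x' ∧ y = y' := by
  have inj := (algebraMap F E).injective
  unfold hasCoord at h h'
  have e : algebraMap F E (y - y') * s = algebraMap F E (x' - x) := by
    rw [map_sub, map_sub]
    linear_combination h' - h
  by_cases hy : y - y' = 0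
  · rw [hy, map_zero, zero_mul] at e
    have : x' - x = 0 := inj (by rw [← e, map_zero])
    exact ⟨(sub_eq_zero.mp this).symm, sub_eq_zero.mp hy⟩
  · refine absurd ⟨(x' - x) / (y - y'), ?_⟩ hc
    have : c * (y - y') ^ 2 = (x' - x) ^ 2 := inj (by
      rw [map_mul, map_pow, map_pow, ← hs, ← e]
      ring)
    field_simp
    linear_combination this

theorem hasCoord.mul {F : Type} [Field F] {c : F}
    {E : Type} [Field E] [Algebra F E] {s : E} (hs : s ^ 2 = algebraMap F E c)
    {α β : E} {x y u v : F} (h : hasCoord F E s α x y) (h' : hasCoord F E s β u v) :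
    hasCoord F E s (α * β) (x * u + c * (y * v)) (x * v + y * u) := by
  unfold hasCoord at *
  rw [h, h']
  simp only [map_add, map_mul, ← hs]
  ring

theorem scalarQK_mul_oneAddJK {F : Type} [Field F] {c : F} {x y x' y' u v : F}
    (h₁ : x' * u + c * (y' * -v) = x * u + c * (y * v))
    (h₂ : x' * -v + y' * u = x * v + y * u) :
    scalarQK F c u v * oneAddJK F c x y = oneAddJK F c x' y' * scalarQK F c u v := by
  have e₁ := congrArg (RatFunc.C (K := F)) h₁
  have e₂ := congrArg (RatFunc.C (K := F)) h₂
  simp only [map_add, map_mul, map_neg] at e₁ e₂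
  ext
  · simp [scalarQK, oneAddJK]
  · simp [scalarQK, oneAddJK]
  · simp [scalarQK, oneAddJK]
    linear_combination -e₁
  · simp [scalarQK, oneAddJK]
    linear_combination -e₂

theorem jquatK_mul_oneAddJK {F : Type} [Field F] (c x y : F) :
    jquatK F c * oneAddJK F c x y = oneAddJK F c x (-y) * jquatK F c := by
  ext <;> simp [jquatK, oneAddJK]

/-- `α·μ = β·μ̄` implies `μ(1 + αj) = (1 + βj)μ`. -/
theorem scalarQK_mul_oneAddJK_of_mul_eq {F : Type} [Field F] [Fintype F]
    (hq : Odd (Fintype.card F)) {c : F} (hc : ¬IsSquare c)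
    {E : Type} [Field E] [Algebra F E] {s : E} (hs : s ^ 2 = algebraMap F E c)
    {α α' μ : E} {x y x' y' u v : F} (hα : hasCoord F E s α x y)
    (hα' : hasCoord F E s α' x' y') (hμ : hasCoord F E s μ u v)
    (h : α' * μ ^ Fintype.card F = α * μ) :
    scalarQK F c u v * oneAddJK F c x y = oneAddJK F c x' y' * scalarQK F c u v := by
  have hbar := hμ.pow_card (pow_card_eq_neg_of_not_isSquare hq hc hs)
  have e := hα'.mul hs hbar
  rw [h] at e
  obtain ⟨h₁, h₂⟩ := e.unique hc hs (hα.mul hs hμ)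
  exact scalarQK_mul_oneAddJK h₁ h₂

theorem isUnit_scalarQK {F : Type} [Field F] {c : F} (hc : ¬IsSquare c)
    {u v : F} (h : u ≠ 0 ∨ v ≠ 0) : IsUnit (scalarQK F c u v) := by
  have hn : u ^ 2 - c * v ^ 2 ≠ 0 := by
    intro h0
    by_cases hv : v = 0
    · subst hv
      simp_all
    · refine hc ⟨u / v, ?_⟩
      field_simp
      linear_combination -h0
  have e := congrArg (RatFunc.C (K := F)) (mul_inv_cancel₀ hn)
  simp only [map_sub, map_mul, map_pow, map_one] at e
  refine isUnit_iff_exists.mpr ⟨scalarQK F c (u * (u ^ 2 - c * v ^ 2)⁻¹)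
    (-v * (u ^ 2 - c * v ^ 2)⁻¹), ?_, ?_⟩ <;>
  ext <;> simp only [scalarQK, QuaternionAlgebra.mk_mul_mk, map_mul, map_neg,
    QuaternionAlgebra.re_one, QuaternionAlgebra.imI_one, QuaternionAlgebra.imJ_one,
    QuaternionAlgebra.imK_one] <;> first | ring1 | linear_combination e

/-- The explicit form of Hilbert 90 for `x ↦ x ^ q`, where `s̄ = -s`. -/
theorem exists_mul_pow_card_eq {F : Type} [Field F] [Fintype F]
    {E : Type} [Field E] [Algebra F E] {s : E} (hs0 : s ≠ 0)
    (hs : s ^ Fintype.card F = -s) {β : E} (hβ : β ^ (Fintype.card F + 1) = 1) :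
    ∃ μ : E, μ ≠ 0 ∧ β * μ ^ Fintype.card F = μ := by
  by_cases h : 1 + β = 0
  · refine ⟨s, hs0, ?_⟩
    rw [hs]
    linear_combination -s * h
  · refine ⟨1 + β, h, ?_⟩
    have hfrob := map_add (FiniteField.frobeniusAlgHom F E) 1 β
    simp only [FiniteField.coe_frobeniusAlgHom, one_pow] at hfrob
    rw [hfrob]
    linear_combination hβ

theorem card_eq_sq_of_hasCoord {F : Type} [Field F] [Fintype F] {c : F} (hc : ¬IsSquare c)
    {E : Type} [Field E] [Algebra F E] {s : E} (hs : s ^ 2 = algebraMap F E c)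
    (hspan : ∀ α : E, ∃ x y : F, hasCoord F E s α x y) :
    Nat.card E = Fintype.card F ^ 2 := by
  have hb : Function.Bijective
      (fun p : F × F => algebraMap F E p.1 + algebraMap F E p.2 * s) := by
    constructor
    · rintro ⟨x, y⟩ ⟨x', y'⟩ h
      obtain ⟨h₁, h₂⟩ := hasCoord.unique hc hs (rfl : hasCoord F E s _ x y) h
      exact Prod.ext h₁ h₂
    · intro α
      obtain ⟨x, y, h⟩ := hspan α
      exact ⟨(x, y), h.symm⟩
  rw [← Nat.card_eq_of_bijective _ hb, Nat.card_prod, Nat.card_eq_fintype_card, sq]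

/-- A field with `q²` elements has `q + 1` elements of norm `a`, for every `a ≠ 0` with
`a ^ (q - 1) = 1`. -/
theorem ncard_pow_succ_eq {E : Type} [Field E] {q : ℕ} (hq : 1 < q) (hE : Nat.card E = q ^ 2)
    {a : E} (ha : a ≠ 0) (haq : a ^ (q - 1) = 1) :
    {α : E | α ^ (q + 1) = a}.ncard = q + 1 := by
  classical
  have : Finite E := Nat.finite_of_card_ne_zero (by rw [hE]; positivity)
  have hcard : Nat.card Eˣ = (q - 1) * (q + 1) := by
    rw [Nat.card_units, hE]
    obtain ⟨k, rfl⟩ := Nat.exists_eq_add_of_lt hq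
    simp only [Nat.add_sub_cancel]
    have : (1 + k + 1) ^ 2 = (1 + k) * (1 + k + 1 + 1) + 1 := by ring
    omega
  obtain ⟨g, hg⟩ := IsCyclic.exists_generator (α := Eˣ)
  have hord : orderOf g = (q - 1) * (q + 1) := by
    rw [orderOf_eq_card_of_forall_mem_zpowers hg, hcard]
  have hprim : IsPrimitiveRoot (g : E) ((q - 1) * (q + 1)) := by
    rw [← hord]
    exact (IsPrimitiveRoot.orderOf g).map_of_injective (f := Units.coeHom E) Units.val_injective
  have hpos : 0 < (q - 1) * (q + 1) := Nat.mul_pos (by omega) (by omega)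
  have hζ := hprim.pow hpos rfl
  have hη := hprim.pow hpos (mul_comm _ _)
  have : NeZero (q - 1) := ⟨by omega⟩
  obtain ⟨i, -, hi⟩ := hη.eq_pow_of_pow_eq_one haq
  have hex : ∃ α : E, α ^ (q + 1) = a := ⟨(g : E) ^ i, by rw [← hi, pow_right_comm]⟩
  have hset : {α : E | α ^ (q + 1) = a} = ((nthRoots (q + 1) a).toFinset : Set E) := by
    ext α
    simp [mem_nthRoots]
  rw [hset, Set.ncard_coe_finset, Multiset.toFinset_card_of_nodup (hζ.nthRoots_nodup ha),
    hζ.card_nthRoots, if_pos hex]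

/-- The set `A_τ = {1 + α·j : N(α) = τ⁻¹}` has `q+1` elements; the
conjugation formulas `μ(1+αj)μ⁻¹ = 1 + (αμ/μ̄)j` and `j(1+αj)j⁻¹ = 1 + ᾱj` hold; and
conjugation by units acts transitively on `A_τ`. -/
theorem Atau_card_and_conjugation
    (F : Type) [Field F] [Fintype F] (hq : Odd (Fintype.card F))
    (c : F) (hc : ¬IsSquare c)
    (E : Type) [Field E] [Algebra F E] (s : E)
    (hs : s ^ 2 = algebraMap F E c)
    (hspan : ∀ α : E, ∃ x y : F, hasCoord F E s α x y)
    (τ : F) (hτ : τ ≠ 0) :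
    -- (1) `A_τ` has exactly `q + 1` elements
    ({z : QAK F c | ∃ (α : E) (x y : F),
        hasCoord F E s α x y ∧
        α ^ (Fintype.card F + 1) = algebraMap F E τ⁻¹ ∧
        z = oneAddJK F c x y}.ncard = Fintype.card F + 1) ∧
    -- (2) `μ(1 + αj)μ⁻¹ = 1 + (α·μ/μ̄)·j` for `μ = u + v·i ≠ 0`
    (∀ (μ : E) (u v : F), hasCoord F E s μ u v → μ ≠ 0 →
      ∀ (α : E) (x y : F), hasCoord F E s α x y →
        α ^ (Fintype.card F + 1) = algebraMap F E τ⁻¹ →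
      ∀ (x' y' : F), hasCoord F E s (α * μ / μ ^ Fintype.card F) x' y' →
      ∀ mu : (QAK F c)ˣ, (mu : QAK F c) = scalarQK F c u v →
        (mu : QAK F c) * oneAddJK F c x y * ((mu⁻¹ : (QAK F c)ˣ) : QAK F c) =
          oneAddJK F c x' y') ∧
    -- (2') `j(1 + αj)j⁻¹ = 1 + ᾱ·j`, where `ᾱ = α^q`
    (∀ (α : E) (x y : F), hasCoord F E s α x y →
        α ^ (Fintype.card F + 1) = algebraMap F E τ⁻¹ →
      ∀ (x' y' : F), hasCoord F E s (α ^ Fintype.card F) x' y' →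
      ∀ ju : (QAK F c)ˣ, (ju : QAK F c) = jquatK F c →
        (ju : QAK F c) * oneAddJK F c x y * ((ju⁻¹ : (QAK F c)ˣ) : QAK F c) =
          oneAddJK F c x' y') ∧
    -- (3) conjugation by units of `𝔽_{q²}ˣ` is transitive on `A_τ`
    (∀ (α α' : E) (x y x' y' : F),
        hasCoord F E s α x y → α ^ (Fintype.card F + 1) = algebraMap F E τ⁻¹ →
        hasCoord F E s α' x' y' → α' ^ (Fintype.card F + 1) = algebraMap F E τ⁻¹ →
      ∃ (μ : E) (u v : F), μ ≠ 0 ∧ hasCoord F E s μ u v ∧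
        ∃ mu : (QAK F c)ˣ, (mu : QAK F c) = scalarQK F c u v ∧
          (mu : QAK F c) * oneAddJK F c x y * ((mu⁻¹ : (QAK F c)ˣ) : QAK F c) =
            oneAddJK F c x' y') := by
  have hsq := pow_card_eq_neg_of_not_isSquare hq hc hs
  have hs0 : s ≠ 0 := by
    rintro rfl
    refine hc ⟨0, (algebraMap F E).injective ?_⟩
    rw [← hs]
    simp
  have hτE : algebraMap F E τ⁻¹ ≠ 0 := by simpa using hτ
  refine ⟨?_, ?_, ?_, ?_⟩
  · choose X Y hXY using hspan
    have himage : {z : QAK F c | ∃ (α : E) (x y : F), hasCoord F E s α x y ∧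
        α ^ (Fintype.card F + 1) = algebraMap F E τ⁻¹ ∧ z = oneAddJK F c x y} =
        (fun α => oneAddJK F c (X α) (Y α)) ''
          {α : E | α ^ (Fintype.card F + 1) = algebraMap F E τ⁻¹} := by
      ext z
      constructor
      · rintro ⟨α, x, y, h, hα, rfl⟩
        obtain ⟨rfl, rfl⟩ := h.unique hc hs (hXY α)
        exact ⟨α, hα, rfl⟩
      · rintro ⟨α, hα, rfl⟩
        exact ⟨α, _, _, hXY α, hα, rfl⟩
    rw [himage, Set.ncard_image_of_injective]
    · refine ncard_pow_succ_eq Fintype.one_lt_card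
        (card_eq_sq_of_hasCoord hc hs fun α => ⟨X α, Y α, hXY α⟩) hτE ?_
      rw [← map_pow, FiniteField.pow_card_sub_one_eq_one _ (inv_ne_zero hτ), map_one]
    · intro α β h
      have h₁ : X α = X β := RatFunc.C.injective (congrArg QuaternionAlgebra.imJ h)
      have h₂ : Y α = Y β := RatFunc.C.injective (congrArg QuaternionAlgebra.imK h)
      have hα := hXY α
      rw [h₁, h₂] at hα
      exact Eq.trans hα (hXY β).symm
  · intro μ u v hμ hμ0 α x y hα _ x' y' hα' mu hmu
    rw [Units.mul_inv_eq_iff_eq_mul, hmu]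
    exact scalarQK_mul_oneAddJK_of_mul_eq hq hc hs hα hα' hμ
      (div_mul_cancel₀ _ (pow_ne_zero _ hμ0))
  · intro α x y hα _ x' y' hα' ju hju
    obtain ⟨rfl, rfl⟩ := hα'.unique hc hs (hα.pow_card hsq)
    rw [Units.mul_inv_eq_iff_eq_mul, hju]
    exact jquatK_mul_oneAddJK c _ _
  · intro α α' x y x' y' hα hαN hα' hαN'
    have hα0 : α ≠ 0 := by
      rintro rfl
      exact hτE (by rw [← hαN]; simp)
    obtain ⟨μ, hμ0, hμ⟩ := exists_mul_pow_card_eq (β := α' / α) hs0 hsq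
      (by rw [div_pow, hαN, hαN', div_self hτE])
    obtain ⟨u, v, huv⟩ := hspan μ
    have huv0 : u ≠ 0 ∨ v ≠ 0 := by
      by_contra! h
      obtain ⟨rfl, rfl⟩ := h
      exact hμ0 (by simpa [hasCoord] using huv)
    obtain ⟨mu, hmu⟩ := isUnit_scalarQK hc huv0
    refine ⟨μ, u, v, hμ0, huv, mu, hmu, ?_⟩
    rw [Units.mul_inv_eq_iff_eq_mul, hmu]
    refine scalarQK_mul_oneAddJK_of_mul_eq hq hc hs hα hα' huv ?_
    field_simp at hμ
    linear_combination hμ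
end
end

section
/- Let K = 𝔽_q(t). For α, β ∈ 𝔽_{q²}ˣ with N(α) ≠ N(β), the element ζ_α(β) := (1 + α/β)/(1 + ᾱ/β̄) is a well-defined element of 𝔽_{q²} of norm 1, and in the quaternion algebra ℍ[K, c, t] the identity (1 + α·j)(1 + β·j) = (1 + (ζ_α(β)·β)·j)(1 + (ζ_β(α)·α)·j) holds. -/
open Polynomial Quaternion

noncomputable section

/-- `ζ_α(β) = (1 + α/β)/(1 + ᾱ/β̄)`, where `ᾱ = α^q`. -/
def zeta (F : Type) [Field F] [Fintype F] (E : Type) [Field E] (α β : E) : E :=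
  (1 + α / β) / (1 + α ^ Fintype.card F / β ^ Fintype.card F)

/-- A square root of a non-square is negated by the Frobenius map. -/
theorem sqrt_pow_card {F E : Type*} [Field F] [Fintype F] (hq : Odd (Fintype.card F))
    {c : F} (hc : ¬IsSquare c) [Field E] [Algebra F E] {s : E} (hs : s ^ 2 = algebraMap F E c) :
    s ^ Fintype.card F = -s := by
  have hF : ringChar F ≠ 2 := fun h => by
    have := FiniteField.even_card_of_char_two h
    rw [Nat.odd_iff] at hq
    omega
  have hc0 : c ≠ 0 := fun h => hc (h ▸ IsSquare.zero)
  have h1 : c ^ (Fintype.card F / 2) = -1 :=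
    (FiniteField.pow_dichotomy hF hc0).resolve_left
      fun h => hc ((FiniteField.isSquare_iff hF hc0).2 h)
  calc s ^ Fintype.card F = s ^ (2 * (Fintype.card F / 2) + 1) := by
        rw [Nat.two_mul_div_two_add_one_of_odd hq]
    _ = -s := by rw [pow_succ, pow_mul, hs, ← map_pow, h1]; simp

/-- Coordinates with respect to `1, √c` are unique when `c` is not a square. -/
theorem coord_unique {F E : Type*} [Field F] [Field E] [Algebra F E]
    {c : F} (hc : ¬IsSquare c) {s : E} (hs : s ^ 2 = algebraMap F E c) {x y x' y' : F}
    (h : algebraMap F E x + algebraMap F E y * s = algebraMap F E x' + algebraMap F E y' * s) :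
    x = x' ∧ y = y' := by
  have hinj := (algebraMap F E).injective
  have key : (x' - x) ^ 2 = (y - y') ^ 2 * c := hinj (by
    simp only [map_pow, map_sub, map_mul, ← hs]
    linear_combination (-(algebraMap F E x' - algebraMap F E x) -
      (algebraMap F E y - algebraMap F E y') * s) * h)
  have hy : y = y' := by
    by_contra hne
    have hne' : y - y' ≠ 0 := sub_ne_zero.2 hne
    refine hc ⟨(x' - x) / (y - y'), ?_⟩
    field_simp
    linear_combination -key
  subst hy
  exact ⟨hinj (add_right_cancel h), rfl⟩

/-- A product of two quaternions `1 + αj`, in coordinates. -/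
theorem oneAddJK_mul (F : Type) [Field F] (c x y x' y' : F) :
    oneAddJK F c x y * oneAddJK F c x' y' =
      ⟨1 + RatFunc.X * RatFunc.C (x * x' - c * y * y'),
        RatFunc.X * RatFunc.C (y * x' - x * y'),
        RatFunc.C (x + x'), RatFunc.C (y + y')⟩ := by
  ext <;> simp [oneAddJK] <;> ring

/-- For `α, β ∈ 𝔽_{q²}ˣ` with `N(α) ≠ N(β)`, `ζ_α(β)` is well defined,
has norm 1, and `(1 + αj)(1 + βj) = (1 + ζ_α(β)β·j)(1 + ζ_β(α)α·j)` in `ℍ[K, c, t]`. -/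
theorem zeta_identity
    (F : Type) [Field F] [Fintype F] (hq : Odd (Fintype.card F))
    (c : F) (hc : ¬IsSquare c)
    (E : Type) [Field E] [Algebra F E] (s : E)
    (hs : s ^ 2 = algebraMap F E c)
    (hspan : ∀ α : E, ∃ x y : F, hasCoord F E s α x y)
    (α β : E) (hα : α ≠ 0) (hβ : β ≠ 0)
    (hN : α ^ (Fintype.card F + 1) ≠ β ^ (Fintype.card F + 1)) :
    -- `ζ_α(β)` is well defined: the denominator `1 + ᾱ/β̄` is nonzero
    (1 + α ^ Fintype.card F / β ^ Fintype.card F ≠ 0) ∧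
    -- `ζ_α(β)` has norm 1
    (zeta F E α β ^ (Fintype.card F + 1) = 1) ∧
    -- the identity `(1 + αj)(1 + βj) = (1 + (ζ_α(β)β)j)(1 + (ζ_β(α)α)j)`
    (∀ (x y x' y' u v u' v' : F),
      hasCoord F E s α x y → hasCoord F E s β x' y' →
      hasCoord F E s (zeta F E α β * β) u v →
      hasCoord F E s (zeta F E β α * α) u' v' →
      oneAddJK F c x y * oneAddJK F c x' y' =
        oneAddJK F c u v * oneAddJK F c u' v') := by
  obtain ⟨φ, hφ⟩ : ∃ φ : E →ₐ[F] E, ∀ a, φ a = a ^ Fintype.card F :=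
    ⟨FiniteField.frobeniusAlgHom F E, fun _ => rfl⟩
  have hφs : φ s = -s := by rw [hφ, sqrt_pow_card hq hc hs]
  have hφφ (a : E) : φ (φ a) = a := by
    obtain ⟨x, y, rfl⟩ := hspan a
    simp [hφs]
  have hsum : α + β ≠ 0 := fun h => hN <| by
    rw [eq_neg_of_add_eq_zero_left h, hq.add_one.neg_pow]
  have hφsum : φ α + φ β ≠ 0 := by
    rw [← map_add]
    exact (map_ne_zero φ).2 hsum
  have hφα : φ α ≠ 0 := (map_ne_zero φ).2 hα
  have hφβ : φ β ≠ 0 := (map_ne_zero φ).2 hβ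
  have hzβ : zeta F E α β * β = (α + β) * φ β / (φ α + φ β) := by
    have : φ β + φ α ≠ 0 := by rwa [add_comm]
    rw [zeta, ← hφ, ← hφ]
    field_simp
    ring
  have hzα : zeta F E β α * α = (α + β) * φ α / (φ α + φ β) := by
    rw [zeta, ← hφ, ← hφ]
    field_simp
  refine ⟨?_, ?_, ?_⟩
  · rw [← hφ, ← hφ, one_add_div hφβ, add_comm]
    exact div_ne_zero hφsum hφβ
  · have hz : zeta F E α β = (α + β) * φ β / (φ α + φ β) / β := by
      rw [← hzβ, mul_div_cancel_right₀ _ hβ]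
    rw [pow_succ, ← hφ, hz]
    simp only [map_div₀, map_mul, map_add, hφφ]
    field_simp
  · intro x y x' y' u v u' v' h1 h2 h3 h4
    have hadd : zeta F E α β * β + zeta F E β α * α = α + β := by
      rw [hzβ, hzα]
      field_simp
      ring
    have hmul : zeta F E α β * β * φ (zeta F E β α * α) = α * φ β := by
      rw [hzβ, hzα]
      simp only [map_div₀, map_mul, map_add, hφφ]
      field_simp
    rw [h3, h4, h1, h2] at hadd hmul
    simp only [map_add, map_mul, AlgHom.commutes, hφs] at hmul
    obtain ⟨ha, hb⟩ := coord_unique (x := x + x') (y := y + y') (x' := u + u') (y' := v + v')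
      hc hs (by simp only [map_add]; linear_combination -hadd)
    obtain ⟨hd, he⟩ := coord_unique (x := x * x' - c * y * y') (y := y * x' - x * y')
      (x' := u * u' - c * v * v') (y' := v * u' - u * v') hc hs (by
        simp only [map_sub, map_mul, ← hs]
        linear_combination -hmul)
    rw [oneAddJK_mul, oneAddJK_mul, ha, hb, hd, he]
end
end

section
/- Let p be the characteristic of 𝔽_q. The group Γ_S is residually p: for every g ∈ Γ_S with g ≠ 1 there exist a finite group P which is a p-group and a group homomorphism φ : Γ_S → P with φ(g) ≠ 1. -/
open Polynomial Quaternion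

noncomputable section

/-- The central subgroup of scalar units. -/
def scalarUnits (R A : Type*) [CommRing R] [Ring A] [Algebra R A] : Subgroup Aˣ :=
  (Units.map (algebraMap R A).toMonoidHom).range

instance scalarUnits_normal (R A : Type*) [CommRing R] [Ring A] [Algebra R A] :
    (scalarUnits R A).Normal := by
  constructor
  intro n hn g
  obtain ⟨r, rfl⟩ := hn
  refine ⟨r, ?_⟩
  ext
  simp only [Units.val_mul, Units.coe_map, RingHom.toMonoidHom_eq_coe, MonoidHom.coe_coe]
  rw [← Algebra.commutes (r : R) ((g : Aˣ) : A), mul_assoc, Units.mul_inv, mul_one]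

/-- The group `Λ_S = ℍ[o_S, c, t]ˣ/o_Sˣ`. -/
abbrev LambdaS (F : Type) [Field F] (S₀ : Set F) (c : F) : Type :=
  (QAS F S₀ c)ˣ ⧸ scalarUnits (OS F S₀) (QAS F S₀ c)

/-- The class `[w]` of a unit `w`. -/
abbrev clsS (F : Type) [Field F] (S₀ : Set F) (c : F) : (QAS F S₀ c)ˣ →* LambdaS F S₀ c :=
  QuotientGroup.mk' _

/-- The canonical map `F → o_S`. -/
def toOS (F : Type) [Field F] (S₀ : Set F) : F →+* OS F S₀ :=
  (algebraMap F[X] (OS F S₀)).comp (C : F →+* F[X])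

/-- The quaternion `1 + α·j = 1 + x·j + y·k` for `α = x + y·√c ∈ 𝔽_{q²}`. -/
def oneAddJ (F : Type) [Field F] (S₀ : Set F) (c : F) (x y : F) : QAS F S₀ c :=
  ⟨1, 0, toOS F S₀ x, toOS F S₀ y⟩

/-- The set `PA_τ = {[1 + α·j] : α ∈ 𝔽_{q²}, N(α) = α^{q+1} = τ⁻¹} ⊆ Λ_S`. -/
def PASet (F : Type) [Field F] [Fintype F] (E : Type) [Field E] [Algebra F E] (s : E)
    (S₀ : Set F) (c : F) (τ : F) : Set (LambdaS F S₀ c) :=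
  {z | ∃ (α : E) (x y : F) (w : (QAS F S₀ c)ˣ),
    hasCoord F E s α x y ∧
    α ^ (Fintype.card F + 1) = algebraMap F E τ⁻¹ ∧
    (w : QAS F S₀ c) = oneAddJ F S₀ c x y ∧
    z = clsS F S₀ c w}

/-- The group `Γ_S`, generated by all `PA_τ`, `τ ∈ S₀`. -/
def GammaS (F : Type) [Field F] [Fintype F] (E : Type) [Field E] [Algebra F E] (s : E)
    (S₀ : Set F) (c : F) : Subgroup (LambdaS F S₀ c) :=
  Subgroup.closure (⋃ τ ∈ S₀, PASet F E s S₀ c τ)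

/-- The ring homomorphism of quaternion algebras induced by a ring homomorphism of the base. -/
def quatMap {R S : Type*} [CommRing R] [CommRing S] (φ : R →+* S) (a b : R) :
    ℍ[R, a, b] →+* ℍ[S, φ a, φ b] where
  toFun w := ⟨φ w.re, φ w.imI, φ w.imJ, φ w.imK⟩
  map_one' := by ext <;> simp
  map_zero' := by ext <;> simp
  map_mul' x y := by ext <;> simp
  map_add' x y := by ext <;> simp

lemma quatMap_star {R S : Type*} [CommRing R] [CommRing S] (φ : R →+* S) (a b : R)
    (w : ℍ[R, a, b]) : quatMap φ a b (star w) = star (quatMap φ a b w) := by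
  ext <;> simp [quatMap]

/-- A quaternion with vanishing imaginary part. -/
def IsScalarQuat {R : Type*} [CommRing R] {a b : R} (w : ℍ[R, a, b]) : Prop :=
  w.imI = 0 ∧ w.imJ = 0 ∧ w.imK = 0

lemma IsScalarQuat.map {R S : Type*} [CommRing R] [CommRing S] (φ : R →+* S) {a b : R}
    {w : ℍ[R, a, b]} (h : IsScalarQuat w) : IsScalarQuat (quatMap φ a b w) := by
  obtain ⟨h₁, h₂, h₃⟩ := h
  simp [IsScalarQuat, quatMap, h₁, h₂, h₃]

lemma IsScalarQuat.of_map {R S : Type*} [CommRing R] [CommRing S] {φ : R →+* S}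
    (hφ : Function.Injective φ) {a b : R}
    {w : ℍ[R, a, b]} (h : IsScalarQuat (quatMap φ a b w)) : IsScalarQuat w := by
  simpa [IsScalarQuat, quatMap, map_eq_zero_iff φ hφ] using h

lemma mem_scalarUnits_iff {R : Type*} [CommRing R] {a b : R} (u : ℍ[R, a, b]ˣ) :
    u ∈ scalarUnits R ℍ[R, a, b] ↔ IsScalarQuat (u : ℍ[R, a, b]) := by
  constructor
  · rintro ⟨r, rfl⟩
    simp [IsScalarQuat, QuaternionAlgebra.algebraMap_eq]
  · rintro ⟨h₁, h₂, h₃⟩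
    have h := congrArg QuaternionAlgebra.re u.mul_inv
    simp only [QuaternionAlgebra.re_mul, h₁, h₂, h₃, QuaternionAlgebra.re_one] at h
    have h' : (u : ℍ[R, a, b]).re * ((u⁻¹ : ℍ[R, a, b]ˣ) : ℍ[R, a, b]).re = 1 := by
      linear_combination h
    refine ⟨Units.mkOfMulEqOne _ _ h', ?_⟩
    ext <;> simp [QuaternionAlgebra.algebraMap_eq, h₁, h₂, h₃]

lemma mk_mul_mk_star {R : Type*} [CommRing R] {a b : R} (u : ℍ[R, a, b]ˣ) :
    (QuotientGroup.mk' (scalarUnits R ℍ[R, a, b]) u) *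
      QuotientGroup.mk' (scalarUnits R ℍ[R, a, b]) (star u) = 1 := by
  rw [← map_mul, QuotientGroup.mk'_apply, QuotientGroup.eq_one_iff, mem_scalarUnits_iff,
    Units.val_mul, Units.coe_star, QuaternionAlgebra.mul_star_eq_coe]
  simp [IsScalarQuat]

lemma mk_eq_mk_iff {R : Type*} [CommRing R] {a b : R} (u v : ℍ[R, a, b]ˣ) :
    QuotientGroup.mk' (scalarUnits R ℍ[R, a, b]) u = QuotientGroup.mk' _ v ↔
      IsScalarQuat ((u : ℍ[R, a, b]) * star (v : ℍ[R, a, b])) := by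
  rw [← mul_left_inj (QuotientGroup.mk' _ (star v)), mk_mul_mk_star, ← map_mul,
    QuotientGroup.mk'_apply, QuotientGroup.eq_one_iff, mem_scalarUnits_iff,
    Units.val_mul, Units.coe_star]

/-- The class modulo scalars of the image of an element of a submonoid of a quaternion algebra,
when a change of base ring makes the submonoid invertible. -/
def projClass {R S : Type*} [CommRing R] [CommRing S] (φ : R →+* S) {a b : R}
    (M : Submonoid ℍ[R, a, b]) (hM : ∀ m ∈ M, IsUnit (quatMap φ a b m)) :
    M →* ℍ[S, φ a, φ b]ˣ ⧸ scalarUnits S ℍ[S, φ a, φ b] :=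
  (QuotientGroup.mk' _).comp
    (IsUnit.liftRight ((quatMap φ a b).toMonoidHom.comp M.subtype) fun m => hM m m.2)

lemma projClass_eq_mk {R S : Type*} [CommRing R] [CommRing S] (φ : R →+* S) {a b : R}
    (M : Submonoid ℍ[R, a, b]) (hM : ∀ m ∈ M, IsUnit (quatMap φ a b m)) (m : M)
    (u : ℍ[S, φ a, φ b]ˣ) (hu : (u : ℍ[S, φ a, φ b]) = quatMap φ a b m) :
    projClass φ M hM m = QuotientGroup.mk' _ u := by
  refine congrArg (QuotientGroup.mk' _) (Units.ext ?_)
  rw [hu]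
  rfl

lemma projClass_eq_iff {R S : Type*} [CommRing R] [CommRing S] (φ : R →+* S) {a b : R}
    (M : Submonoid ℍ[R, a, b]) (hM : ∀ m ∈ M, IsUnit (quatMap φ a b m)) (m m' : M) :
    projClass φ M hM m = projClass φ M hM m' ↔
      IsScalarQuat (quatMap φ a b ((m : ℍ[R, a, b]) * star (m' : ℍ[R, a, b]))) := by
  rw [projClass_eq_mk φ M hM m (hM m m.2).unit rfl, projClass_eq_mk φ M hM m' (hM m' m'.2).unit rfl,
    mk_eq_mk_iff, map_mul, quatMap_star]
  rfl

lemma projClass_eq_one_iff {R S : Type*} [CommRing R] [CommRing S] (φ : R →+* S) {a b : R}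
    (M : Submonoid ℍ[R, a, b]) (hM : ∀ m ∈ M, IsUnit (quatMap φ a b m)) (m : M) :
    projClass φ M hM m = 1 ↔ IsScalarQuat (quatMap φ a b (m : ℍ[R, a, b])) := by
  rw [← map_one (projClass φ M hM), projClass_eq_iff, Submonoid.coe_one, star_one, mul_one]

/-- A monoid homomorphism to a finite group, whose image consists of elements of `p`-power order,
induces a homomorphism to a finite `p`-group on any subgroup covered by a compatible
homomorphism. -/
lemma exists_pGroup_hom {M G : Type*} {H : Type} [Monoid M] [Group G] [Group H] [Finite H]
    (f : M →* G) (g : M →* H) (Γ : Subgroup G) (hΓ : ∀ γ ∈ Γ, ∃ m, f m = γ)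
    (hfg : ∀ m m', f m = f m' → g m = g m') (p : ℕ) (hg : ∀ m, ∃ k, g m ^ p ^ k = 1)
    (γ : Γ) (m : M) (hm : f m = γ) (hne : g m ≠ 1) :
    ∃ (P : Type) (hG : Group P),
      haveI := hG
      Finite P ∧ IsPGroup p P ∧ ∃ φ : Γ →* P, φ γ ≠ 1 := by
  choose l hl using fun γ : Γ => hΓ γ γ.2
  let φ : Γ →* H := MonoidHom.mk' (fun γ => g (l γ)) fun x y => by
    rw [← map_mul]
    exact hfg _ _ (by rw [map_mul, hl, hl, hl]; rfl)
  refine ⟨φ.range, inferInstance, inferInstance, ?_, φ.rangeRestrict, fun h => hne ?_⟩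
  · rintro ⟨_, x, rfl⟩
    obtain ⟨k, hk⟩ := hg (l x)
    exact ⟨k, Subtype.ext hk⟩
  · rw [hfg m (l γ) (by rw [hl, hm])]
    exact congrArg Subtype.val h

/-- The quaternions over `F[t]` that are congruent to `1` modulo `j` and become invertible
over `o_S`. -/
def congrOneMonoid (F : Type) [Field F] (S₀ : Set F) (c : F) : Submonoid ℍ[F[X], C c, X] where
  carrier := {w | X ∣ w.re - 1 ∧ X ∣ w.imI ∧
    IsUnit (quatMap (algebraMap F[X] (OS F S₀)) (C c) X w)}
  one_mem' := by simp
  mul_mem' := by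
    rintro x y ⟨⟨x₁, hx₁⟩, ⟨x₂, hx₂⟩, hx⟩ ⟨⟨y₁, hy₁⟩, ⟨y₂, hy₂⟩, hy⟩
    refine ⟨⟨x₁ * y.re + y₁ + C c * x₂ * y.imI + x.imJ * y.imJ - C c * x.imK * y.imK, ?_⟩,
      ⟨x.re * y₂ + x₂ * y.re - x.imJ * y.imK + x.imK * y.imJ, ?_⟩, ?_⟩
    · simp only [QuaternionAlgebra.re_mul]
      linear_combination y.re * hx₁ + hy₁ + C c * y.imI * hx₂
    · simp only [QuaternionAlgebra.imI_mul]
      linear_combination x.re * hy₂ + y.re * hx₂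
    · rw [map_mul]
      exact hx.mul hy

lemma star_mem_congrOneMonoid {F : Type} [Field F] {S₀ : Set F} {c : F} {w : ℍ[F[X], C c, X]}
    (hw : w ∈ congrOneMonoid F S₀ c) : star w ∈ congrOneMonoid F S₀ c := by
  obtain ⟨h₁, h₂, h₃⟩ := hw
  refine ⟨by simpa using h₁, by simpa using h₂, ?_⟩
  rw [quatMap_star]
  exact h₃.star

lemma algebraMap_OS_injective (F : Type) [Field F] (S₀ : Set F) :
    Function.Injective (algebraMap F[X] (OS F S₀)) := by
  refine IsLocalization.injective (OS F S₀) (M := sden F S₀) (Submonoid.closure_le.2 ?_)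
  rintro f (rfl | ⟨τ, -, rfl⟩)
  · exact mem_nonZeroDivisors_of_ne_zero X_ne_zero
  · exact mem_nonZeroDivisors_of_ne_zero (X_sub_C_ne_zero τ)

lemma exists_sq_eq_X_smul {F : Type} [Field F] {c : F} {z : ℍ[F[X], C c, X]}
    (h₁ : X ∣ z.re) (h₂ : X ∣ z.imI) : ∃ y : ℍ[F[X], C c, X], z ^ 2 = (X : F[X]) • y := by
  obtain ⟨a, ha⟩ := h₁
  obtain ⟨b, hb⟩ := h₂
  refine ⟨⟨z.re * a + C c * z.imI * b + z.imJ * z.imJ - C c * z.imK * z.imK,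
    2 * a * z.imI, 2 * a * z.imJ, 2 * a * z.imK⟩, ?_⟩
  rw [pow_two]
  ext1
  · simp only [QuaternionAlgebra.re_mul, QuaternionAlgebra.re_smul, smul_eq_mul]
    linear_combination z.re * ha + C c * z.imI * hb
  · simp only [QuaternionAlgebra.imI_mul, QuaternionAlgebra.imI_smul, smul_eq_mul]
    linear_combination 2 * z.imI * ha
  · simp only [QuaternionAlgebra.imJ_mul, QuaternionAlgebra.imJ_smul, smul_eq_mul]
    linear_combination 2 * z.imJ * ha
  · simp only [QuaternionAlgebra.imK_mul, QuaternionAlgebra.imK_smul, smul_eq_mul]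
    linear_combination 2 * z.imK * ha

lemma quatMap_pow_char_pow_eq_one {F : Type} [Field F] {c : F} (p : ℕ) [hp : Fact p.Prime]
    [CharP F p] {w : ℍ[F[X], C c, X]} (h₁ : X ∣ w.re - 1) (h₂ : X ∣ w.imI) (n : ℕ) :
    quatMap (Ideal.Quotient.mk (Ideal.span {(X : F[X]) ^ n})) (C c) X w ^ p ^ (2 * n) = 1 := by
  have : CharP ℍ[F[X], C c, X] p :=
    charP_of_injective_algebraMap
      (QuaternionAlgebra.algebraMap_injective (R := F[X]) (c₁ := C c) (c₂ := 0) (c₃ := X)) p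
  obtain ⟨y, hy⟩ := exists_sq_eq_X_smul (c := c) (z := w - 1) (by simpa using h₁) (by simpa using h₂)
  have hw : w ^ p ^ (2 * n) = 1 + (w - 1) ^ p ^ (2 * n) := by
    have h := add_pow_expChar_pow_of_commute p (2 * n) (Commute.one_left (w - 1))
    rwa [one_pow, add_sub_cancel] at h
  have hle : 2 * n ≤ p ^ (2 * n) := (Nat.lt_pow_self hp.out.one_lt).le
  have hX : quatMap (Ideal.Quotient.mk (Ideal.span {(X : F[X]) ^ n})) (C c) X
      ((w - 1) ^ (2 * n)) = 0 := by
    have hq : Ideal.Quotient.mk (Ideal.span {(X : F[X]) ^ n}) (X ^ n) = 0 :=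
      Ideal.Quotient.eq_zero_iff_mem.2 (Ideal.mem_span_singleton_self _)
    rw [pow_mul, hy, _root_.smul_pow]
    ext <;> simp only [quatMap, RingHom.coe_mk, MonoidHom.coe_mk, OneHom.coe_mk,
      QuaternionAlgebra.re_smul, QuaternionAlgebra.imI_smul, QuaternionAlgebra.imJ_smul,
      QuaternionAlgebra.imK_smul, smul_eq_mul, map_mul, hq, zero_mul] <;> rfl
  rw [← map_pow, hw, ← Nat.sub_add_cancel hle, pow_add, map_add, map_mul, hX, mul_zero, map_one,
    add_zero]

lemma isUnit_quatMap_quotient {F : Type} [Field F] {S₀ : Set F} {c : F} (p : ℕ)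
    [hp : Fact p.Prime] [CharP F p] (n : ℕ) :
    ∀ w ∈ congrOneMonoid F S₀ c,
      IsUnit (quatMap (Ideal.Quotient.mk (Ideal.span {(X : F[X]) ^ n})) (C c) X w) :=
  fun _ hw => IsUnit.of_pow_eq_one (quatMap_pow_char_pow_eq_one p hw.1 hw.2.1 n)
    (pow_ne_zero _ hp.out.ne_zero)

lemma projClass_quotient_pow_char_pow {F : Type} [Field F] {S₀ : Set F} {c : F} (p : ℕ)
    [Fact p.Prime] [CharP F p] (n : ℕ) (w : congrOneMonoid F S₀ c) :
    projClass (Ideal.Quotient.mk (Ideal.span {(X : F[X]) ^ n})) (congrOneMonoid F S₀ c)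
      (isUnit_quatMap_quotient p n) w ^ p ^ (2 * n) = 1 := by
  rw [← map_pow, projClass_eq_one_iff, SubmonoidClass.coe_pow, map_pow,
    quatMap_pow_char_pow_eq_one p w.2.1 w.2.2.1]
  simp [IsScalarQuat]

lemma exists_not_isScalarQuat_quatMap {F : Type} [Field F] {c : F} {w : ℍ[F[X], C c, X]}
    (hw : ¬IsScalarQuat w) :
    ∃ n, ¬IsScalarQuat
      (quatMap (Ideal.Quotient.mk (Ideal.span {(X : F[X]) ^ n})) (C c) X w) := by
  have key : ∀ (e : F[X]) (n : ℕ), e.natDegree < n →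
      Ideal.Quotient.mk (Ideal.span {(X : F[X]) ^ n}) e = 0 → e = 0 := by
    intro e n hn he
    rw [Ideal.Quotient.eq_zero_iff_mem, Ideal.mem_span_singleton] at he
    by_contra h
    have := natDegree_le_of_dvd he h
    rw [natDegree_X_pow] at this
    omega
  refine ⟨w.imI.natDegree + w.imJ.natDegree + w.imK.natDegree + 1, fun h => hw ?_⟩
  exact ⟨key _ _ (by omega) h.1, key _ _ (by omega) h.2.1, key _ _ (by omega) h.2.2⟩

lemma finite_quat {R : Type*} [CommRing R] [Finite R] (a b : R) : Finite ℍ[R, a, b] :=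
  .of_equiv _ (QuaternionAlgebra.equivProd a 0 b).symm

lemma exists_projClass_eq_of_mem_GammaS {F : Type} [Field F] [Fintype F] {E : Type} [Field E]
    [Algebra F E] {s : E} {S₀ : Set F} {c : F} (γ : LambdaS F S₀ c) (hγ : γ ∈ GammaS F E s S₀ c) :
    ∃ m, projClass (algebraMap F[X] (OS F S₀)) (congrOneMonoid F S₀ c) (fun _ h => h.2.2) m
      = γ := by
  unfold GammaS at hγ
  induction hγ using Subgroup.closure_induction with
  | mem z hz =>
    obtain ⟨τ, -, α, x, y, w, -, -, hw, rfl⟩ := by simpa only [Set.mem_iUnion, exists_prop] using hz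
    have h : quatMap (algebraMap F[X] (OS F S₀)) (C c) X ⟨1, 0, C x, C y⟩ = w := by
      rw [hw]
      ext <;> simp [quatMap, oneAddJ, toOS]
    exact ⟨⟨⟨1, 0, C x, C y⟩, by simp, by simp, h ▸ w.isUnit⟩, projClass_eq_mk _ _ _ _ _ h.symm⟩
  | one => exact ⟨1, map_one _⟩
  | mul x y _ _ hx hy =>
    obtain ⟨⟨m, rfl⟩, m', rfl⟩ := hx, hy
    exact ⟨m * m', map_mul _ _ _⟩
  | inv x _ hx =>
    obtain ⟨m, rfl⟩ := hx
    refine ⟨⟨star (m : ℍ[F[X], C c, X]), star_mem_congrOneMonoid m.2⟩, ?_⟩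
    rw [eq_inv_iff_mul_eq_one, ← map_mul, projClass_eq_one_iff]
    refine IsScalarQuat.map _ ?_
    rw [Submonoid.coe_mul, QuaternionAlgebra.star_mul_eq_coe]
    simp [IsScalarQuat]

/-- `Γ_S` is residually `p`, where `p = char 𝔽_q`. -/
theorem gammaS_residually_p
    (F : Type) [Field F] [Fintype F] (hq : Odd (Fintype.card F))
    (c : F) (hc : ¬IsSquare c)
    (E : Type) [Field E] [Algebra F E] (s : E)
    (hs : s ^ 2 = algebraMap F E c)
    (hspan : ∀ α : E, ∃ x y : F, hasCoord F E s α x y)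
    (S₀ : Set F) (hS₀ : (0 : F) ∉ S₀)
    (p : ℕ) (hp : p.Prime) (hcharp : CharP F p) :
    ∀ g : GammaS F E s S₀ c, g ≠ 1 →
      ∃ (P : Type) (hG : Group P),
        haveI := hG
        Finite P ∧ IsPGroup p P ∧ ∃ φ : (GammaS F E s S₀ c) →* P, φ g ≠ 1 := by
  have : Fact p.Prime := ⟨hp⟩
  rintro ⟨g, hg⟩ hg1
  obtain ⟨m, hm⟩ := exists_projClass_eq_of_mem_GammaS g hg
  have hns : ¬IsScalarQuat (m : ℍ[F[X], C c, X]) := by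
    refine fun h => hg1 (Subtype.ext ?_)
    exact hm.symm.trans ((projClass_eq_one_iff _ _ _ _).2 (h.map _))
  obtain ⟨n, hn⟩ := exists_not_isScalarQuat_quatMap hns
  have : Module.Finite F (F[X] ⧸ Ideal.span {(X : F[X]) ^ n}) := (monic_X_pow n).finite_quotient
  have : Finite (F[X] ⧸ Ideal.span {(X : F[X]) ^ n}) := Module.finite_of_finite F
  have := finite_quat (Ideal.Quotient.mk (Ideal.span {(X : F[X]) ^ n}) (C c))
    (Ideal.Quotient.mk (Ideal.span {(X : F[X]) ^ n}) X)
  refine exists_pGroup_hom _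
    (projClass (Ideal.Quotient.mk (Ideal.span {(X : F[X]) ^ n})) (congrOneMonoid F S₀ c)
      (isUnit_quatMap_quotient p n))
    (GammaS F E s S₀ c) exists_projClass_eq_of_mem_GammaS (fun m m' h => ?_) p
    (fun w => ⟨2 * n, projClass_quotient_pow_char_pow p n w⟩) ⟨g, hg⟩ m hm
    fun h => hn ((projClass_eq_one_iff _ _ _ _).1 h)
  rw [projClass_eq_iff] at h ⊢
  exact (h.of_map (algebraMap_OS_injective F S₀)).map _
end
end
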